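/- arXiv:1911.08986 — 2 statements merged into one kernel-verified Lean document; each statement's English description precedes it below -/
import Mathlib

section
/- Let C be a regular Mal'tsev category and X a simplicial object in C. Then the three equivalence relations d_0(D_1 ∧ D_2), d_1(D_0 ∧ D_2), and d_2(D_0 ∧ D_1) on X_1 are all equal, where D_0, D_1, D_2 are the kernel pairs of the face morphisms d_0, d_1, d_2 : X_2 → X_1. -/
open CategoryTheory CategoryTheory.Limits Opposite Simplicial

universe v u

namespace Paper

variable {C : Type u} [Category.{v} C]

/-- A morphism is a regular epimorphism (as a proposition). -/
def IsRegEpi {A B : C} (f : A ⟶ B) : Prop := Nonempty (RegularEpi f)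

section Rels

variable [HasFiniteLimits C]

/-- An internal relation on `X` is a subobject of `X ⨯ X`. -/
abbrev Rel (X : C) := Subobject (X ⨯ X)

/-- A pair of generalized elements `a, b : Z ⟶ X` belongs to the relation `S`. -/
def relMem {X Z : C} (S : Rel X) (a b : Z ⟶ X) : Prop := S.Factors (prod.lift a b)

/-- An internal relation is reflexive. -/
def IsReflRel {X : C} (S : Rel X) : Prop := ∀ (Z : C) (a : Z ⟶ X), relMem S a a

/-- An internal relation is symmetric. -/
def IsSymmRel {X : C} (S : Rel X) : Prop :=
  ∀ (Z : C) (a b : Z ⟶ X), relMem S a b → relMem S b a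

/-- An internal relation is transitive. -/
def IsTransRel {X : C} (S : Rel X) : Prop :=
  ∀ (Z : C) (a b c : Z ⟶ X), relMem S a b → relMem S b c → relMem S a c

/-- An internal relation is an equivalence relation. -/
def IsEquivRel {X : C} (S : Rel X) : Prop := IsReflRel S ∧ IsSymmRel S ∧ IsTransRel S

instance monoDiag (X : C) : Mono (diag X) :=
  mono_of_mono_fac (prod.lift_fst (𝟙 X) (𝟙 X))

/-- The diagonal (discrete) relation `Δ_X` on `X`. -/
noncomputable def diagSub (X : C) : Rel X := Subobject.mk (diag X)

/-- The kernel pair of `f : A ⟶ B`, as an internal (equivalence) relation on `A`. -/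
noncomputable def kp {A B : C} (f : A ⟶ B) : Rel A :=
  (Subobject.pullback (prod.map f f)).obj (diagSub B)

variable [HasImages C]

/-- The direct image of a relation `S` on `A` along `f : A ⟶ B`. -/
noncomputable def dimg {A B : C} (f : A ⟶ B) (S : Rel A) : Rel B :=
  imageSubobject (S.arrow ≫ prod.map f f)

end Rels

/-- A regular category: finitely complete, with coequalizers of kernel pairs,
pullback-stable regular epimorphisms, and (regular epi)-mono factorizations. -/
class RegularCat (C : Type u) [Category.{v} C] extends HasFiniteLimits C, HasImages C : Prop where
  coeq_kernelPair : ∀ {A B : C} (f : A ⟶ B), HasCoequalizer (pullback.fst f f) (pullback.snd f f)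
  regEpi_pullback : ∀ {A B D : C} (f : A ⟶ B) (g : D ⟶ B), IsRegEpi f →
    IsRegEpi (pullback.snd f g)
  regEpi_factorThruImage : ∀ {A B : C} (f : A ⟶ B), IsRegEpi (factorThruImage f)

/-- A regular Mal'tsev category: a regular category in which every internal reflexive
relation is an equivalence relation. -/
class RegularMaltsevCat (C : Type u) [Category.{v} C] extends RegularCat C : Prop where
  maltsev : ∀ (X : C) (S : Rel X), IsReflRel S → IsEquivRel S

/-- An exact (Barr-exact) Mal'tsev category: regular Mal'tsev, and every internal
equivalence relation is a kernel pair. -/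
class ExactMaltsevCat (C : Type u) [Category.{v} C] extends RegularMaltsevCat C : Prop where
  effective : ∀ (X : C) (S : Rel X), IsEquivRel S → ∃ (B : C) (f : X ⟶ B), S = kp f

/-- A simplicial object is (the nerve of) an internal groupoid:  for every `n ≥ 2` the
square with sides `d_0 : X_n → X_{n-1}`, `d_n : X_n → X_{n-1}`, `d_{n-1}` and `d_0`
is a pullback. -/
def IsGrpdObj (X : SimplicialObject C) : Prop :=
  ∀ n : ℕ, IsPullback (X.δ (0 : Fin (n+3))) (X.δ (Fin.last (n+2)))
    (X.δ (Fin.last (n+1))) (X.δ (0 : Fin (n+2)))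

theorem IsRegEpi.strongEpi {A B : C} {f : A ⟶ B} (hf : IsRegEpi f) : StrongEpi f :=
  have : IsRegularEpi f := ⟨hf⟩
  inferInstance

theorem factors_of_strongEpi_comp {Y Z Z' : C} {S : Subobject Y} (q : Z' ⟶ Z) [StrongEpi q]
    {g : Z ⟶ Y} (h : S.Factors (q ≫ g)) : S.Factors g := by
  have sq : CommSq (S.factorThru _ h) q S.arrow g := ⟨by simp⟩
  rw [← sq.fac_right]
  exact Subobject.factors_comp_arrow _

section Rels

variable [HasFiniteLimits C] {A B X Z : C}

theorem relMem_kp_iff (f : A ⟶ B) (a b : Z ⟶ A) : relMem (kp f) a b ↔ a ≫ f = b ≫ f := by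
  unfold relMem kp diagSub
  rw [pullback_factors_iff, Subobject.mk_factors_iff, prod.lift_map]
  constructor
  · rintro ⟨(g : Z ⟶ B), hg : g ≫ diag B = _⟩
    rw [← prod.lift_fst (a ≫ f) (b ≫ f), ← hg]
    conv_rhs => rw [← prod.lift_snd (a ≫ f) (b ≫ f), ← hg]
    simp only [diag, Category.assoc, prod.lift_fst, prod.lift_snd]
  · intro h
    exact ⟨a ≫ f, by ext <;> simp [MonoOver.arrow, h]⟩

theorem relMem_inf_iff (S T : Rel X) (a b : Z ⟶ X) :
    relMem (S ⊓ T) a b ↔ relMem S a b ∧ relMem T a b :=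
  Subobject.inf_factors _

theorem relMem_arrow (S : Rel X) : relMem S (S.arrow ≫ prod.fst) (S.arrow ≫ prod.snd) := by
  unfold relMem
  rw [← prod.comp_lift, prod.lift_fst_snd, Category.comp_id]
  exact Subobject.factors_self S

variable [HasImages C]

theorem relMem.dimg {S : Rel A} {a b : Z ⟶ A} (h : relMem S a b) (f : A ⟶ B) :
    relMem (dimg f S) (a ≫ f) (b ≫ f) := by
  unfold relMem Paper.dimg
  rw [← prod.lift_map, ← Subobject.factorThru_arrow S _ h, Category.assoc]
  exact imageSubobject_factors_comp_self _ _

theorem dimg_le {S : Rel A} {T : Rel B} (f : A ⟶ B)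
    (h : relMem T (S.arrow ≫ prod.fst ≫ f) (S.arrow ≫ prod.snd ≫ f)) : dimg f S ≤ T := by
  have e : prod.lift (S.arrow ≫ prod.fst ≫ f) (S.arrow ≫ prod.snd ≫ f) =
      S.arrow ≫ prod.map f f := by ext <;> simp [prod.lift_fst, prod.lift_snd]
  unfold relMem at h
  rw [e] at h
  exact imageSubobject_le _ (T.factorThru _ h) (T.factorThru_arrow _ h)

end Rels

theorem exists_cover_of_factors_imageSubobject [RegularCat C] {W Y Z : C} (f : W ⟶ Y) {g : Z ⟶ Y}
    (h : (imageSubobject f).Factors g) :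
    ∃ (Z' : C) (q : Z' ⟶ Z) (l : Z' ⟶ W), StrongEpi q ∧ q ≫ g = l ≫ f := by
  let t : Z ⟶ image f := (imageSubobject f).factorThru g h ≫ (imageSubobjectIso f).hom
  have ht : t ≫ image.ι f = g := by simp [t]
  refine ⟨_, pullback.snd (factorThruImage f) t, pullback.fst _ _,
    (RegularCat.regEpi_pullback _ _ (RegularCat.regEpi_factorThruImage f)).strongEpi, ?_⟩
  have hc := pullback.condition_assoc (f := factorThruImage f) (g := t) (image.ι f)
  rw [image.fac, ht] at hc
  exact hc.symm

/-- Kernel pairs permute, locally: if `y` agrees with `a` along `d` and with `a'` along `e` and `f`,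
then, on a cover, some `z` agrees with `a'` along `d` and with `a` along `e` and `f`. -/
theorem exists_cover_of_kp_comp [RegularMaltsevCat C] {A B B' B'' Z : C} (d : A ⟶ B) (e : A ⟶ B')
    (f : A ⟶ B'') {a y a' : Z ⟶ A} (hd : a ≫ d = y ≫ d) (he : y ≫ e = a' ≫ e)
    (hf : y ≫ f = a' ≫ f) :
    ∃ (Z' : C) (q : Z' ⟶ Z) (z : Z' ⟶ A), StrongEpi q ∧ z ≫ d = q ≫ a' ≫ d ∧
      z ≫ e = q ≫ a ≫ e ∧ z ≫ f = q ≫ a ≫ f := by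
  let S : Rel A := kp e ⊓ kp f
  let p₁ : (S : C) ⟶ A := S.arrow ≫ prod.fst
  let p₂ : (S : C) ⟶ A := S.arrow ≫ prod.snd
  obtain ⟨hpe, hpf⟩ := (relMem_inf_iff _ _ _ _).1 (relMem_arrow S)
  have hpe : p₁ ≫ e = p₂ ≫ e := (relMem_kp_iff _ _ _).1 hpe
  have hpf : p₁ ≫ f = p₂ ≫ f := (relMem_kp_iff _ _ _).1 hpf
  let m := prod.lift (pullback.fst d (p₁ ≫ d)) (pullback.snd d (p₁ ≫ d) ≫ p₂)
  let T : Rel A := imageSubobject m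
  have hT {Z : C} {a y a' : Z ⟶ A} (hd : a ≫ d = y ≫ d) (he : y ≫ e = a' ≫ e)
      (hf : y ≫ f = a' ≫ f) : relMem T a a' := by
    have hS : relMem S y a' :=
      (relMem_inf_iff _ _ _ _).2 ⟨(relMem_kp_iff _ _ _).2 he, (relMem_kp_iff _ _ _).2 hf⟩
    let s : Z ⟶ (S : C) := S.factorThru _ hS
    have hs : s ≫ S.arrow = prod.lift y a' := S.factorThru_arrow _ hS
    have hs₁ : s ≫ p₁ = y := by simp [p₁, reassoc_of% hs, prod.lift_fst]
    have hs₂ : s ≫ p₂ = a' := by simp [p₂, reassoc_of% hs, prod.lift_snd]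
    have hm : pullback.lift a s (by rw [hd, ← hs₁, Category.assoc]) ≫ m = prod.lift a a' := by
      ext <;> simp [m, hs₂, prod.lift_fst, prod.lift_snd, pullback.lift_fst, pullback.lift_snd_assoc]
    unfold relMem
    rw [← hm]
    exact imageSubobject_factors_comp_self _ _
  have hsymm : relMem T a' a :=
    (RegularMaltsevCat.maltsev A T fun _ _ => hT rfl rfl rfl).2.1 _ _ _ (hT hd he hf)
  obtain ⟨Z', q, l, hq, hl⟩ := exists_cover_of_factors_imageSubobject m hsymm
  have hl₁ : q ≫ a' = l ≫ pullback.fst _ _ := by simpa [m, prod.lift_fst] using hl =≫ prod.fst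
  have hl₂ : q ≫ a = l ≫ pullback.snd _ _ ≫ p₂ := by simpa [m, prod.lift_snd] using hl =≫ prod.snd
  refine ⟨Z', q, l ≫ pullback.snd _ _ ≫ p₁, hq, ?_, ?_, ?_⟩
  · rw [reassoc_of% hl₁, pullback.condition]
    simp
  · simp [reassoc_of% hl₂, hpe]
  · simp [reassoc_of% hl₂, hpf]

/-- In a regular Mal'tsev category, `d(E ∧ F) ≤ e(D ∧ F)` when `d` and `e` have a common section
`s` such that `s ≫ f` identifies elements related by `d(E ∧ F)`. -/
theorem dimg_kp_inf_le [RegularMaltsevCat C] {A B B' K : C} {d e : A ⟶ B} {f : A ⟶ B'}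
    {s : B ⟶ A} {k : B ⟶ K} {u : K ⟶ B'} {v : B' ⟶ K} (hsd : s ≫ d = 𝟙 B) (hse : s ≫ e = 𝟙 B)
    (hsf : s ≫ f = k ≫ u) (hdk : d ≫ k = f ≫ v) :
    dimg d (kp e ⊓ kp f) ≤ dimg e (kp d ⊓ kp f) := by
  apply dimg_le
  obtain ⟨he, hf⟩ := (relMem_inf_iff _ _ _ _).1 (relMem_arrow (kp e ⊓ kp f))
  rw [relMem_kp_iff] at he hf
  simp only [← Category.assoc]
  generalize (kp e ⊓ kp f).arrow ≫ prod.fst = y at he hf ⊢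
  generalize (kp e ⊓ kp f).arrow ≫ prod.snd = y' at he hf ⊢
  obtain ⟨Z', q, z, _, hzd, hze, hzf⟩ :=
    exists_cover_of_kp_comp d e f (a := (y ≫ d) ≫ s) (by simp [hsd]) he hf
  apply factors_of_strongEpi_comp q
  have key : relMem (kp d ⊓ kp f) z (q ≫ y' ≫ d ≫ s) := by
    rw [relMem_inf_iff, relMem_kp_iff, relMem_kp_iff]
    refine ⟨by simp [hzd, hsd], ?_⟩
    simp [hzf, hsf, reassoc_of% hdk, reassoc_of% hf]
  have := key.dimg e
  simp only [hze, Category.assoc, hse, Category.comp_id] at this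
  unfold relMem at this
  rwa [prod.comp_lift]

/-- In a regular Mal'tsev category, for any simplicial object `X` the three
equivalence relations `d_0(D_1 ∧ D_2)`, `d_1(D_0 ∧ D_2)` and `d_2(D_0 ∧ D_1)` on `X_1`
coincide (their common value is `H_1(X)`). -/
theorem statement2 {C : Type u} [Category.{v} C] [RegularMaltsevCat C]
    (X : SimplicialObject C) :
    dimg (X.δ (0 : Fin 3)) (kp (X.δ (1 : Fin 3)) ⊓ kp (X.δ (2 : Fin 3))) =
      dimg (X.δ (1 : Fin 3)) (kp (X.δ (0 : Fin 3)) ⊓ kp (X.δ (2 : Fin 3))) ∧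
    dimg (X.δ (1 : Fin 3)) (kp (X.δ (0 : Fin 3)) ⊓ kp (X.δ (2 : Fin 3))) =
      dimg (X.δ (2 : Fin 3)) (kp (X.δ (0 : Fin 3)) ⊓ kp (X.δ (1 : Fin 3))) := by
  have h₀ : X.σ (0 : Fin 2) ≫ X.δ (0 : Fin 3) = 𝟙 _ := X.δ_comp_σ_self
  have h₁ : X.σ (0 : Fin 2) ≫ X.δ (1 : Fin 3) = 𝟙 _ := X.δ_comp_σ_succ
  have h₂ : X.σ (0 : Fin 2) ≫ X.δ (2 : Fin 3) = X.δ (1 : Fin 2) ≫ X.σ (0 : Fin 1) :=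
    X.δ_comp_σ_of_gt (i := 1) (j := 0) (by decide)
  have h₀' : X.σ (1 : Fin 2) ≫ X.δ (0 : Fin 3) = X.δ (0 : Fin 2) ≫ X.σ (0 : Fin 1) :=
    X.δ_comp_σ_of_le (i := 0) (j := 0) (by decide)
  have h₁' : X.σ (1 : Fin 2) ≫ X.δ (1 : Fin 3) = 𝟙 _ := X.δ_comp_σ_self (i := 1)
  have h₂' : X.σ (1 : Fin 2) ≫ X.δ (2 : Fin 3) = 𝟙 _ := X.δ_comp_σ_succ (i := 1)
  have d₀₁ : X.δ (1 : Fin 3) ≫ X.δ (0 : Fin 2) = X.δ (0 : Fin 3) ≫ X.δ (0 : Fin 2) :=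
    X.δ_comp_δ (i := 0) (j := 0) le_rfl
  have d₀₂ : X.δ (2 : Fin 3) ≫ X.δ (0 : Fin 2) = X.δ (0 : Fin 3) ≫ X.δ (1 : Fin 2) :=
    X.δ_comp_δ (i := 0) (j := 1) (by decide)
  have d₁₂ : X.δ (2 : Fin 3) ≫ X.δ (1 : Fin 2) = X.δ (1 : Fin 3) ≫ X.δ (1 : Fin 2) :=
    X.δ_comp_δ (i := 1) (j := 1) le_rfl
  refine ⟨(dimg_kp_inf_le h₀ h₁ h₂ d₀₂.symm).antisymm (dimg_kp_inf_le h₁ h₀ h₂ d₁₂.symm), ?_⟩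
  rw [inf_comm (kp (X.δ 0)) (kp (X.δ 2)), inf_comm (kp (X.δ 0)) (kp (X.δ 1))]
  exact (dimg_kp_inf_le h₁' h₂' h₀' d₀₁).antisymm (dimg_kp_inf_le h₂' h₁' h₀' d₀₂)

end Paper
end

section
/- Let C be a regular Mal'tsev category. Then the full subcategory Grpd(C) of internal groupoids, regarded inside the category Simp(C) of simplicial objects via the nerve, is closed under quotients (regular epimorphic images) and under subobjects (monomorphisms): if a regular epimorphism of simplicial objects has domain a groupoid then its codomain is a groupoid, and if a monomorphism of simplicial objects has codomain a groupoid then its domain is a groupoid. -/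
open CategoryTheory CategoryTheory.Limits Opposite Simplicial

universe v u

namespace Paper

variable {C : Type u} [Category.{v} C]

theorem comp_prod_lift_eq_iff [HasFiniteLimits C] {R A B Z : C} (p : R ⟶ A) (q : R ⟶ B)
    (a b : Z ⟶ R) :
    a ≫ prod.lift p q = b ≫ prod.lift p q ↔ a ≫ p = b ≫ p ∧ a ≫ q = b ≫ q := by
  refine ⟨fun h => ⟨?_, ?_⟩, fun h => ?_⟩
  · simpa only [Category.assoc, prod.lift_fst] using h =≫ prod.fst
  · simpa only [Category.assoc, prod.lift_snd] using h =≫ prod.snd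
  · rw [prod.comp_lift, prod.comp_lift, h.1, h.2]

theorem mono_prod_lift_iff [HasFiniteLimits C] {R A B : C} (p : R ⟶ A) (q : R ⟶ B) :
    Mono (prod.lift p q) ↔
      ∀ (Z : C) (a b : Z ⟶ R), a ≫ p = b ≫ p → a ≫ q = b ≫ q → a = b :=
  ⟨fun _ _ a b hp hq =>
    (cancel_mono (prod.lift p q)).1 ((comp_prod_lift_eq_iff p q a b).2 ⟨hp, hq⟩),
  fun h => ⟨fun a b hab =>
    have := (comp_prod_lift_eq_iff p q a b).1 hab
    h _ a b this.1 this.2⟩⟩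

/-- In a Mal'tsev category, every jointly monic span is a difunctional relation. -/
theorem exists_of_difunctional [RegularMaltsevCat C] {R A B : C} (p : R ⟶ A) (q : R ⟶ B)
    [Mono (prod.lift p q)] {Z : C} (r₁ r₂ r₃ : Z ⟶ R) (hq : r₁ ≫ q = r₂ ≫ q)
    (hp : r₂ ≫ p = r₃ ≫ p) : ∃ r : Z ⟶ R, r ≫ p = r₁ ≫ p ∧ r ≫ q = r₃ ≫ q := by
  let S : Rel R := Subobject.mk (pullback.snd (prod.lift p q) (prod.map p q))
  have mem_iff : ∀ {W : C} (a b : W ⟶ R),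
      relMem S a b ↔ ∃ r : W ⟶ R, r ≫ p = a ≫ p ∧ r ≫ q = b ≫ q := by
    intro W a b
    unfold relMem
    rw [Subobject.mk_factors_iff]
    constructor
    · intro hab
      obtain ⟨g, hg⟩ : ∃ g : W ⟶ pullback (prod.lift p q) (prod.map p q),
        g ≫ pullback.snd _ _ = prod.lift a b := hab
      have h := g ≫= pullback.condition (f := prod.lift p q) (g := prod.map p q)
      rw [reassoc_of% hg, prod.lift_map, prod.comp_lift, prod.comp_lift] at h
      refine ⟨g ≫ pullback.fst _ _, ?_, ?_⟩
      · simpa only [prod.lift_fst, Category.assoc] using h =≫ prod.fst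
      · simpa only [prod.lift_snd, Category.assoc] using h =≫ prod.snd
    · rintro ⟨r, h₁, h₂⟩
      exact ⟨pullback.lift r (prod.lift a b) (by ext <;> simp [h₁, h₂]), pullback.lift_snd _ _ _⟩
  have hrefl : IsReflRel S := fun W a => (mem_iff a a).2 ⟨a, rfl, rfl⟩
  have hsymm := (RegularMaltsevCat.maltsev R S hrefl).2.1
  exact (mem_iff r₁ r₃).1 (hsymm Z r₃ r₁ ((mem_iff r₃ r₁).2 ⟨r₂, hp, hq.symm⟩))

/-- A commutative square of split epimorphisms with compatible sections. -/
structure IsSplitSquare {P Q O : C} (d₀ d₁ : P ⟶ Q) (e₁ e₀ : Q ⟶ O) (s₀ s₁ : Q ⟶ P)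
    (t : O ⟶ Q) : Prop where
  w : d₀ ≫ e₁ = d₁ ≫ e₀
  s₀_d₀ : s₀ ≫ d₀ = 𝟙 Q
  s₁_d₁ : s₁ ≫ d₁ = 𝟙 Q
  s₀_d₁ : s₀ ≫ d₁ = e₁ ≫ t

namespace IsSplitSquare

variable {P Q O : C} {d₀ d₁ : P ⟶ Q} {e₁ e₀ : Q ⟶ O} {s₀ s₁ : Q ⟶ P} {t : O ⟶ Q}

theorem corner (h : IsSplitSquare d₀ d₁ e₁ e₀ s₀ s₁ t) : s₁ ≫ d₀ ≫ e₁ = e₀ := by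
  rw [h.w, reassoc_of% h.s₁_d₁]

/-- In a Mal'tsev category, a split square with jointly monic projections is a pullback. -/
theorem isPullback [RegularMaltsevCat C] (h : IsSplitSquare d₀ d₁ e₁ e₀ s₀ s₁ t)
    [Mono (prod.lift d₀ d₁)] : IsPullback d₀ d₁ e₁ e₀ := by
  have key : ∀ c : PullbackCone e₁ e₀, ∃ r : c.pt ⟶ P, r ≫ d₀ = c.fst ∧ r ≫ d₁ = c.snd := by
    intro c
    obtain ⟨r, h₀, h₁⟩ := exists_of_difunctional d₀ d₁ (c.fst ≫ s₀) (c.snd ≫ s₁ ≫ d₀ ≫ s₀)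
      (c.snd ≫ s₁) (by simp [reassoc_of% h.corner, h.s₀_d₁, c.condition_assoc])
      (by simp [h.s₀_d₀])
    exact ⟨r, by simpa [h.s₀_d₀] using h₀, by simpa [h.s₁_d₁] using h₁⟩
  choose l h₀ h₁ using key
  exact ⟨⟨h.w⟩, ⟨PullbackCone.IsLimit.mk h.w l h₀ h₁ fun c m hm₀ hm₁ =>
    (mono_prod_lift_iff d₀ d₁).1 inferInstance _ _ _ (hm₀.trans (h₀ c).symm)
      (hm₁.trans (h₁ c).symm)⟩⟩

end IsSplitSquare

theorem mono_prod_lift_of_isPullback [HasFiniteLimits C] {P A B O : C} {p : P ⟶ A} {q : P ⟶ B}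
    {f : A ⟶ O} {g : B ⟶ O} (h : IsPullback p q f g) : Mono (prod.lift p q) :=
  (mono_prod_lift_iff p q).2 fun _ _ _ => h.hom_ext

theorem exists_epi_lift [RegularCat C] {A B Z : C} {f : A ⟶ B} (hf : IsRegEpi f) (y : Z ⟶ B) :
    ∃ (W : C) (π : W ⟶ Z) (x : W ⟶ A), Epi π ∧ x ≫ f = π ≫ y := by
  obtain ⟨hπ⟩ := RegularCat.regEpi_pullback f y hf
  exact ⟨_, pullback.snd f y, pullback.fst f y, hπ.epi, pullback.condition⟩

/-- In a regular Mal'tsev category, joint monicity of the projections of a split square passes to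
quotients of split squares. -/
theorem IsSplitSquare.mono_of_regEpi [RegularMaltsevCat C] {P Q O P' Q' : C}
    {d₀ d₁ : P ⟶ Q} {e₁ e₀ : Q ⟶ O} {s₀ s₁ : Q ⟶ P} {t : O ⟶ Q}
    (h : IsSplitSquare d₀ d₁ e₁ e₀ s₀ s₁ t) [Mono (prod.lift d₀ d₁)]
    {d₀' d₁' : P' ⟶ Q'} {s₀' s₁' : Q' ⟶ P'} {f : P ⟶ P'} {g : Q ⟶ Q'} (hf : IsRegEpi f)
    (hd₀ : d₀ ≫ g = f ≫ d₀') (hd₁ : d₁ ≫ g = f ≫ d₁')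
    (hs₀ : s₀ ≫ f = g ≫ s₀') (hs₁ : s₁ ≫ f = g ≫ s₁') : Mono (prod.lift d₀' d₁') := by
  have hP := (mono_prod_lift_iff d₀ d₁).1 inferInstance
  -- The kernel pair of `f`, as a relation between pairs of elements of `Q`.
  let k₁ := pullback.fst f f
  let k₂ := pullback.snd f f
  let p : pullback f f ⟶ Q ⨯ Q := prod.lift (k₁ ≫ d₀) (k₂ ≫ d₀)
  let q : pullback f f ⟶ Q ⨯ Q := prod.lift (k₁ ≫ d₁) (k₂ ≫ d₁)
  have : Mono (prod.lift p q) := by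
    rw [mono_prod_lift_iff]
    intro Z a b hp hq
    obtain ⟨hp₁, hp₂⟩ := (comp_prod_lift_eq_iff _ _ _ _).1 hp
    obtain ⟨hq₁, hq₂⟩ := (comp_prod_lift_eq_iff _ _ _ _).1 hq
    exact pullback.hom_ext (hP _ _ _ (by simpa using hp₁) (by simpa using hq₁))
      (hP _ _ _ (by simpa using hp₂) (by simpa using hq₂))
  have key : ∀ {Z : C} (x x' : Z ⟶ P), x ≫ f ≫ d₀' = x' ≫ f ≫ d₀' →
      x ≫ f ≫ d₁' = x' ≫ f ≫ d₁' → x ≫ f = x' ≫ f := by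
    intro Z x x' h₀ h₁
    have exists_lift : ∀ a b : Z ⟶ P, a ≫ f = b ≫ f →
        ∃ r : Z ⟶ pullback f f, r ≫ k₁ = a ∧ r ≫ k₂ = b := fun a b hab =>
      ⟨pullback.lift a b hab, pullback.lift_fst _ _ _, pullback.lift_snd _ _ _⟩
    obtain ⟨r₁, hr₁, hr₁'⟩ := exists_lift (x ≫ d₀ ≫ s₀) (x' ≫ d₀ ≫ s₀)
      (by simp only [Category.assoc, hs₀, reassoc_of% hd₀, reassoc_of% h₀])
    obtain ⟨r₃, hr₃, hr₃'⟩ := exists_lift (x ≫ d₁ ≫ s₁) (x' ≫ d₁ ≫ s₁)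
      (by simp only [Category.assoc, hs₁, reassoc_of% hd₁, reassoc_of% h₁])
    obtain ⟨r₂, hr₂, hr₂'⟩ := exists_lift (x ≫ d₁ ≫ s₁ ≫ d₀ ≫ s₀) (x' ≫ d₁ ≫ s₁ ≫ d₀ ≫ s₀)
      (by simp only [Category.assoc, hs₀, reassoc_of% hd₀, reassoc_of% hs₁, reassoc_of% hd₁,
            reassoc_of% h₁])
    obtain ⟨r, hrp, hrq⟩ := exists_of_difunctional p q r₁ r₂ r₃
      ((comp_prod_lift_eq_iff _ _ _ _).2 (by
        simp only [reassoc_of% hr₁, reassoc_of% hr₁', reassoc_of% hr₂, reassoc_of% hr₂',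
          h.s₀_d₁, reassoc_of% h.w, reassoc_of% h.s₁_d₁, and_self]))
      ((comp_prod_lift_eq_iff _ _ _ _).2 (by
        simp only [reassoc_of% hr₂, reassoc_of% hr₂', reassoc_of% hr₃, reassoc_of% hr₃',
          h.s₀_d₀, Category.comp_id, and_self]))
    obtain ⟨h₁₀, h₂₀⟩ := (comp_prod_lift_eq_iff _ _ _ _).1 hrp
    obtain ⟨h₁₁, h₂₁⟩ := (comp_prod_lift_eq_iff _ _ _ _).1 hrq
    have hx : r ≫ k₁ = x := hP _ _ _
      (by simpa only [reassoc_of% hr₁, Category.assoc, h.s₀_d₀, Category.comp_id] using h₁₀)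
      (by simpa only [reassoc_of% hr₃, Category.assoc, h.s₁_d₁, Category.comp_id] using h₁₁)
    have hx' : r ≫ k₂ = x' := hP _ _ _
      (by simpa only [reassoc_of% hr₁', Category.assoc, h.s₀_d₀, Category.comp_id] using h₂₀)
      (by simpa only [reassoc_of% hr₃', Category.assoc, h.s₁_d₁, Category.comp_id] using h₂₁)
    rw [← hx, ← hx', Category.assoc, Category.assoc]
    exact r ≫= pullback.condition
  rw [mono_prod_lift_iff]
  intro Z y y' h₀ h₁
  obtain ⟨W, π, x, _, hx⟩ := exists_epi_lift hf y
  obtain ⟨W', π', x', _, hx'⟩ := exists_epi_lift hf (π ≫ y')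
  rw [← cancel_epi π, ← cancel_epi π', ← hx', ← hx, ← Category.assoc]
  refine key _ _ ?_ ?_
  · simp [reassoc_of% hx, reassoc_of% hx', h₀]
  · simp [reassoc_of% hx, reassoc_of% hx', h₁]

theorem isSplitSquare_δ (X : SimplicialObject C) (n : ℕ) :
    IsSplitSquare (X.δ (0 : Fin (n + 3))) (X.δ (Fin.last (n + 2))) (X.δ (Fin.last (n + 1)))
      (X.δ (0 : Fin (n + 2))) (X.σ 0) (X.σ (Fin.last (n + 1))) (X.σ (0 : Fin (n + 1))) where
  w := (X.δ_comp_δ (Fin.zero_le (Fin.last (n + 1)))).symm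
  s₀_d₀ := X.δ_comp_σ_self
  s₁_d₁ := X.δ_comp_σ_succ
  s₀_d₁ := X.δ_comp_σ_of_gt (i := Fin.last (n + 1)) (j := 0) (Fin.last_pos)

theorem isGrpdObj_iff [RegularMaltsevCat C] (X : SimplicialObject C) :
    IsGrpdObj X ↔
      ∀ n : ℕ, Mono (prod.lift (X.δ (0 : Fin (n + 3))) (X.δ (Fin.last (n + 2)))) :=
  ⟨fun h n => mono_prod_lift_of_isPullback (h n), fun h n =>
    have := h n
    (isSplitSquare_δ X n).isPullback⟩

/-- In a functor category with regular codomain, regular epimorphisms are regular epimorphisms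
componentwise. -/
theorem IsRegEpi.app [RegularCat C] {J : Type*} [Category* J] {F G : J ⥤ C} {f : F ⟶ G}
    (hf : IsRegEpi f) (j : J) : IsRegEpi (f.app j) := by
  obtain ⟨hf⟩ := hf
  have hK : IsKernelPair f (pullback.fst f f) (pullback.snd f f) := IsPullback.of_hasPullback f f
  have : ∀ k, HasColimit ((parallelPair (pullback.fst f f) (pullback.snd f f)).flip.obj k) := by
    intro k
    have hk : IsPullback ((pullback.fst f f).app k) ((pullback.snd f f).app k) (f.app k)
      (f.app k) := hK.map ((evaluation J C).obj k)
    have := RegularCat.coeq_kernelPair (f.app k)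
    let e : (parallelPair (pullback.fst f f) (pullback.snd f f)).flip.obj k ≅
        parallelPair (pullback.fst (f.app k) (f.app k)) (pullback.snd (f.app k) (f.app k)) :=
      diagramIsoParallelPair _ ≪≫ parallelPair.ext hk.isoPullback (Iso.refl _)
        (by simp) (by simp)
    exact hasColimit_of_iso e
  exact ⟨⟨_, _, _, _, isColimitCoforkMapOfIsColimit ((evaluation J C).obj j) _
    (hK.toCoequalizer hf)⟩⟩

/-- In a regular Mal'tsev category, the full subcategory of internal
groupoids is closed in the category of simplicial objects under quotients (regular
epimorphic images) and under subobjects (monomorphisms). -/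
theorem statement5 {C : Type u} [Category.{v} C] [RegularMaltsevCat C] :
    (∀ (X Y : SimplicialObject C) (f : X ⟶ Y), IsRegEpi f → IsGrpdObj X → IsGrpdObj Y) ∧
    (∀ (X Y : SimplicialObject C) (f : X ⟶ Y), Mono f → IsGrpdObj Y → IsGrpdObj X) := by
  refine ⟨fun X Y f hf hX => ?_, fun X Y f _ hY => ?_⟩
  · rw [isGrpdObj_iff] at hX ⊢
    intro n
    have := hX n
    exact (isSplitSquare_δ X n).mono_of_regEpi (hf.app _)
      (SimplicialObject.δ_naturality f _) (SimplicialObject.δ_naturality f _)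
      (SimplicialObject.σ_naturality f _) (SimplicialObject.σ_naturality f _)
  · rw [isGrpdObj_iff] at hY ⊢
    intro n
    have hn := (mono_prod_lift_iff _ _).1 (hY n)
    rw [mono_prod_lift_iff]
    intro Z a b h₀ h₁
    have : Mono (f.app (op ⦋n + 2⦌)) := (NatTrans.mono_iff_mono_app f).1 inferInstance _
    rw [← cancel_mono (f.app (op ⦋n + 2⦌))]
    refine hn _ _ _ ?_ ?_
    · simp only [Category.assoc, ← SimplicialObject.δ_naturality, reassoc_of% h₀]
    · simp only [Category.assoc, ← SimplicialObject.δ_naturality, reassoc_of% h₁]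

end Paper
end
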